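/- Let k be a positive integer. Then the positive integer solutions of x² − (9k²−6)y² = 4 are exactly the pairs (xₙ, yₙ) = (Vₙ(6k²−2,−1), 2k·Uₙ(6k²−2,−1)) for n ≥ 1; that is, a pair of positive integers (x, y) satisfies x² − (9k²−6)y² = 4 if and only if there exists n ≥ 1 with x = Vₙ(6k²−2,−1) and y = 2k·Uₙ(6k²−2,−1). -/

import Mathlib

/-- Generalized Fibonacci sequence: `U₀(k,s) = 0`, `U₁(k,s) = 1`,
`U_{n+1}(k,s) = k·Uₙ(k,s) + s·U_{n−1}(k,s)`. -/
def genFib (k s : ℤ) : ℕ → ℤ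
  | 0 => 0
  | 1 => 1
  | n + 2 => k * genFib k s (n + 1) + s * genFib k s n

/-- Generalized Lucas sequence: `V₀(k,s) = 2`, `V₁(k,s) = k`,
`V_{n+1}(k,s) = k·Vₙ(k,s) + s·V_{n−1}(k,s)`. -/
def genLucas (k s : ℤ) : ℕ → ℤ
  | 0 => 2
  | 1 => k
  | n + 2 => k * genLucas k s (n + 1) + s * genLucas k s n

theorem two_mul_genFib_succ (k s : ℤ) (n : ℕ) :
    2 * genFib k s (n + 1) = k * genFib k s n + genLucas k s n := by
  induction n using Nat.twoStepInduction with
  | zero => simp [genFib, genLucas]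
  | one => simp [genFib, genLucas]; ring
  | more n h₁ h₂ =>
    simp only [genFib, genLucas] at h₁ h₂ ⊢
    linear_combination s * h₁ + k * h₂

theorem two_mul_genLucas_succ (k s : ℤ) (n : ℕ) :
    2 * genLucas k s (n + 1) = k * genLucas k s n + (k ^ 2 + 4 * s) * genFib k s n := by
  induction n using Nat.twoStepInduction with
  | zero => simp [genFib, genLucas]; ring
  | one => simp [genFib, genLucas]; ring
  | more n h₁ h₂ =>
    simp only [genFib, genLucas] at h₁ h₂ ⊢
    linear_combination s * h₁ + k * h₂

theorem genLucas_sq_sub_genFib_sq (k s : ℤ) (n : ℕ) :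
    genLucas k s n ^ 2 - (k ^ 2 + 4 * s) * genFib k s n ^ 2 = 4 * (-s) ^ n := by
  induction n with
  | zero => simp [genFib, genLucas]
  | succ n ih =>
    have hU := two_mul_genFib_succ k s n
    have hV := two_mul_genLucas_succ k s n
    refine mul_left_cancel₀ (four_ne_zero : (4 : ℤ) ≠ 0) ?_
    rw [show 4 * (genLucas k s (n + 1) ^ 2 - (k ^ 2 + 4 * s) * genFib k s (n + 1) ^ 2) =
      (2 * genLucas k s (n + 1)) ^ 2 - (k ^ 2 + 4 * s) * (2 * genFib k s (n + 1)) ^ 2 by ring,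
      hU, hV, pow_succ]
    linear_combination -4 * s * ih

/-- The smallest positive solution of `x² − (9k² − 6)y² = 4` has `y = 2k`. -/
theorem two_mul_le_of_pell_four {k x y : ℤ} (hk : 0 < k) (hx : 0 < x) (hy : 0 < y)
    (h : x ^ 2 - (9 * k ^ 2 - 6) * y ^ 2 = 4) : 2 * k ≤ y := by
  obtain ⟨t, rfl⟩ : ∃ t, x = 3 * k * y - t := ⟨3 * k * y - x, by ring⟩
  have ht : t ^ 2 = 2 * (3 * k * y * t - 3 * y ^ 2 + 2) := by linear_combination h
  obtain ⟨u, rfl⟩ : (2 : ℤ) ∣ t := Int.prime_two.dvd_of_dvd_pow ⟨_, ht⟩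
  have hy2 : y ^ 2 = 2 * (u ^ 2 - 3 * k * y * u + 2 * y ^ 2 - 1) := by linarith
  obtain ⟨z, rfl⟩ : (2 : ℤ) ∣ y := Int.prime_two.dvd_of_dvd_pow ⟨_, hy2⟩
  have hz : 0 < z := by linarith
  have hu : u * (6 * k * z - u) = 6 * z ^ 2 - 1 := by linarith
  have hkz : 0 < k * z := mul_pos hk hz
  have hu' : 0 < 6 * k * z - u := by nlinarith
  have hu0 : 0 < u := pos_of_mul_pos_left (by nlinarith : 0 < u * (6 * k * z - u)) hu'.le
  have : 0 ≤ (u - 1) * (6 * k * z - u - 1) := mul_nonneg (by omega) (by omega)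
  have : k * z ≤ z * z := by linarith
  linarith [le_of_mul_le_mul_right this hz]

theorem exists_eq_genLucas_of_pell_four {k : ℤ} (hk : 0 < k) (m : ℕ) :
    ∀ x y : ℤ, 0 < x → 0 ≤ y → y.toNat = m → x ^ 2 - (9 * k ^ 2 - 6) * y ^ 2 = 4 →
      ∃ n : ℕ, x = genLucas (6 * k ^ 2 - 2) (-1) n ∧
        y = 2 * k * genFib (6 * k ^ 2 - 2) (-1) n := by
  induction m using Nat.strong_induction_on with
  | _ m ih =>
  intro x y hx hy hm h
  obtain rfl | hy0 := hy.eq_or_lt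
  · exact ⟨0, by simp only [genLucas]; nlinarith, by simp [genFib]⟩
  have hle := two_mul_le_of_pell_four hk hx hy0 h
  have hk1 : 1 ≤ k ^ 2 := by nlinarith
  have hy' : 0 ≤ (3 * k ^ 2 - 1) * y - k * x := by
    refine sub_nonneg.2 (abs_le_of_sq_le_sq' ?_ (mul_nonneg (by linarith) hy)).2
    have : (2 * k) ^ 2 ≤ y ^ 2 := pow_le_pow_left₀ (by linarith) hle 2
    linear_combination this + k ^ 2 * h
  have hlt : (3 * k ^ 2 - 1) * y - k * x < y := by
    have : (3 * k ^ 2 - 2) * y < k * x := by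
      refine lt_of_pow_lt_pow_left₀ 2 (mul_pos hk hx).le ?_
      have : 0 ≤ (6 * k ^ 2 - 4) * y ^ 2 := mul_nonneg (by linarith) (sq_nonneg y)
      linear_combination 4 * hk1 + this - k ^ 2 * h
    linarith
  have hx' : 0 < (3 * k ^ 2 - 1) * x - (9 * k ^ 2 - 6) * k * y := by
    refine sub_pos.2 (lt_of_pow_lt_pow_left₀ 2 (mul_nonneg (by linarith) hx.le) ?_)
    have : 0 < x ^ 2 := pow_pos hx 2
    have : 0 ≤ (9 * k ^ 2 - 6) * k ^ 2 := mul_nonneg (by linarith) (sq_nonneg k)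
    linear_combination ‹0 < x ^ 2› + 4 * this - (9 * k ^ 2 - 6) * k ^ 2 * h
  obtain ⟨n, hV, hU⟩ := ih _ (by omega) _ _ hx' hy' rfl (by linear_combination h)
  have hV' := two_mul_genLucas_succ (6 * k ^ 2 - 2) (-1) n
  have hU' := two_mul_genFib_succ (6 * k ^ 2 - 2) (-1) n
  refine ⟨n + 1, ?_, ?_⟩
  · refine mul_left_cancel₀ (two_ne_zero : (2 : ℤ) ≠ 0) ?_
    rw [hV', ← hV]
    linear_combination 2 * (9 * k ^ 2 - 6) * k * hU
  · linear_combination (3 * k ^ 2 - 1) * hU + k * hV - k * hU'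

/-- For a positive integer `k`, the positive integer solutions of `x² − (9k² − 6)y² = 4`
are exactly the pairs `(Vₙ(6k²−2,−1), 2k·Uₙ(6k²−2,−1))` for `n ≥ 1`. -/
theorem pell_four_sols_nine_k_sq_sub_six (k : ℤ) (hk : 0 < k)
    (x y : ℤ) (hx : 0 < x) (hy : 0 < y) :
    x ^ 2 - (9 * k ^ 2 - 6) * y ^ 2 = 4 ↔
      ∃ n : ℕ, 1 ≤ n ∧ x = genLucas (6 * k ^ 2 - 2) (-1) n ∧
        y = 2 * k * genFib (6 * k ^ 2 - 2) (-1) n := by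
  constructor
  · intro h
    obtain ⟨n, hV, hU⟩ := exists_eq_genLucas_of_pell_four hk _ x y hx hy.le rfl h
    refine ⟨n, Nat.one_le_iff_ne_zero.2 ?_, hV, hU⟩
    rintro rfl
    simp [genFib] at hU
    exact hy.ne' hU
  · rintro ⟨n, -, rfl, rfl⟩
    have h := genLucas_sq_sub_genFib_sq (6 * k ^ 2 - 2) (-1) n
    rw [neg_neg, one_pow] at h
    linear_combination h
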